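/- The extreme points of the convex set U_1 are exactly the functions h_κ(z) = -z(κ+z)/(κ-z) for κ on the unit circle. -/

import Mathlib

open scoped Classical

open Metric Complex

/-- The class `U₁`, realized as functions on `ℂ` that vanish outside the unit disk
(so that the locally-uniform-convergence structure on `Hol(𝔻,ℂ)` is faithfully encoded
by the values on the disk). -/
def U1 : Set (ℂ → ℂ) :=
  {h | DifferentiableOn ℂ h (ball 0 1) ∧ h 0 = 0 ∧ deriv h 0 = -1 ∧
    (∀ z ∈ ball (0:ℂ) 1, (h z * (starRingEnd ℂ) z).re ≤ 0) ∧
    ∀ z ∉ ball (0:ℂ) 1, h z = 0}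

/-- If the real part of a holomorphic function is nonnegative on the unit circle, then it is
nonnegative on the disk. -/
lemma re_nonneg_of_re_nonneg_on_sphere {f : ℂ → ℂ} (hf : DiffContOnCl ℂ f (ball 0 1))
    (h : ∀ z ∈ sphere (0 : ℂ) 1, 0 ≤ (f z).re) {z : ℂ} (hz : z ∈ ball (0 : ℂ) 1) :
    0 ≤ (f z).re := by
  have hd : DiffContOnCl ℂ (fun w => Complex.exp (-f w)) (ball 0 1) :=
    Complex.differentiable_exp.comp_diffContOnCl hf.neg
  have := Complex.norm_le_of_forall_mem_frontier_norm_le isBounded_ball hd (C := 1)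
    (fun w hw => by
      rw [frontier_ball _ one_ne_zero] at hw
      simpa [Complex.norm_exp] using h w hw) (subset_closure hz)
  simpa [Complex.norm_exp] using this

/-- The Carathéodory class of normalized holomorphic functions with nonnegative real part. -/
def caratheodoryClass : Set (ℂ → ℂ) :=
  {p | DifferentiableOn ℂ p (ball 0 1) ∧ p 0 = 1 ∧ ∀ z ∈ ball (0 : ℂ) 1, 0 ≤ (p z).re}

/-- The element of `U1` associated with a member of the Carathéodory class. -/
noncomputable def ofCaratheodory (p : ℂ → ℂ) : ℂ → ℂ :=
  fun z => if z ∈ ball (0 : ℂ) 1 then -z * p z else 0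

/-- In terms of the Herglotz measure `μ` of `p`, the Herglotz transform of
`Re (a κ) dμ(κ)`. -/
noncomputable def modulation (p : ℂ → ℂ) (a z : ℂ) : ℂ :=
  (a * (z * p z + z + starRingEnd ℂ (deriv p 0 / 2)) +
    starRingEnd ℂ a * (dslope p 0 z - deriv p 0 / 2)) / 2

lemma modulation_neg (p : ℂ → ℂ) (a z : ℂ) : modulation p (-a) z = -modulation p a z := by
  simp only [modulation, map_neg]
  ring

lemma modulation_zero (p : ℂ → ℂ) (a : ℂ) :
    modulation p a 0 = ((a * starRingEnd ℂ (deriv p 0 / 2)).re : ℂ) := by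
  have := Complex.add_conj (a * starRingEnd ℂ (deriv p 0 / 2))
  simp only [modulation, dslope_same]
  rw [map_mul, Complex.conj_conj] at this
  push_cast at this
  linear_combination (1 / 2) * this

lemma re_add_modulation_of_conj_mul (a z P M : ℂ) :
    (P + (a * (z * P + z + starRingEnd ℂ M) +
      starRingEnd ℂ a * (starRingEnd ℂ z * (P - 1) - M)) / 2).re = (1 + (a * z).re) * P.re := by
  have h2 : ∀ w : ℂ, (w / 2).re = w.re / 2 := fun w => by
    simp
  simp only [Complex.add_re, h2, Complex.mul_re, Complex.sub_re, Complex.add_im, Complex.mul_im,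
    Complex.sub_im, Complex.conj_re, Complex.conj_im, Complex.one_re, Complex.one_im]
  ring

lemma DifferentiableOn.dslope_ball {p : ℂ → ℂ} (hp : DifferentiableOn ℂ p (ball 0 1)) :
    DifferentiableOn ℂ (dslope p 0) (ball 0 1) :=
  (Complex.differentiableOn_dslope (ball_mem_nhds _ one_pos)).2 hp

lemma modulation_differentiableOn {p : ℂ → ℂ} (hp : DifferentiableOn ℂ p (ball 0 1)) (a : ℂ) :
    DifferentiableOn ℂ (modulation p a) (ball 0 1) := by
  have := hp.dslope_ball
  unfold modulation
  fun_prop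

open Filter Topology in
lemma re_add_modulation_nonneg {p : ℂ → ℂ} (hp : p ∈ caratheodoryClass) {a : ℂ} (ha : ‖a‖ ≤ 1)
    {z : ℂ} (hz : z ∈ ball (0 : ℂ) 1) : 0 ≤ (p z + modulation p a z).re := by
  obtain ⟨hd, h0, hre⟩ := hp
  have hs := hd.dslope_ball
  set m := deriv p 0 / 2 with hm
  let G : ℝ → ℂ → ℂ := fun r w => p (r * w) +
    (a * (w * p (r * w) + w + starRingEnd ℂ (r * m)) +
      starRingEnd ℂ a * (r * dslope p 0 (r * w) - r * m)) / 2
  have hG : ∀ r : ℝ, 0 < r → r < 1 → 0 ≤ (G r z).re := by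
    intro r hr0 hr1
    have hmaps : Set.MapsTo (fun w : ℂ => (r : ℂ) * w) (closedBall 0 1) (ball 0 1) := by
      intro w hw
      simp only [mem_closedBall_zero_iff, mem_ball_zero_iff, norm_mul, Complex.norm_real,
        Real.norm_eq_abs, abs_of_pos hr0] at hw ⊢
      nlinarith [norm_nonneg w]
    have hc : ∀ {f : ℂ → ℂ}, DifferentiableOn ℂ f (ball 0 1) →
        DiffContOnCl ℂ (fun w => f (r * w)) (ball 0 1) := by
      intro f hf
      refine DifferentiableOn.diffContOnCl ?_
      rw [closure_ball _ one_ne_zero]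
      exact hf.comp (by fun_prop) hmaps
    refine re_nonneg_of_re_nonneg_on_sphere (f := G r) ?_ ?_ hz
    · have key : ∀ P S : ℂ → ℂ, DiffContOnCl ℂ P (ball 0 1) → DiffContOnCl ℂ S (ball 0 1) →
          DiffContOnCl ℂ (fun w => P w + (a * (w * P w + w + starRingEnd ℂ (r * m)) +
            starRingEnd ℂ a * (r * S w - r * m)) / 2) (ball 0 1) := by
        rintro P S ⟨hP, hPc⟩ ⟨hS, hSc⟩
        exact ⟨by fun_prop, by fun_prop⟩
      exact key _ _ (hc hd) (hc hs)
    · intro w hw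
      have hw1 : ‖w‖ = 1 := by simpa using hw
      have hin := hmaps (sphere_subset_closedBall hw)
      have hww : starRingEnd ℂ w * w = 1 := by
        rw [Complex.conj_mul', hw1]; norm_num
      have hsl : (r : ℂ) * dslope p 0 (r * w) = starRingEnd ℂ w * (p (r * w) - 1) := by
        have := sub_smul_dslope p 0 ((r : ℂ) * w)
        rw [h0, sub_zero, smul_eq_mul] at this
        linear_combination starRingEnd ℂ w * this - r * dslope p 0 (r * w) * hww
      simp only [G]
      rw [hsl, re_add_modulation_of_conj_mul]
      refine mul_nonneg ?_ (hre _ hin)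
      have : |(a * w).re| ≤ 1 := (Complex.abs_re_le_norm _).trans (by rw [norm_mul, hw1]; linarith)
      linarith [neg_abs_le (a * w).re]
  have hcont : ContinuousAt (fun r : ℝ => (G r z).re) 1 := by
    have hz_nhds : ball (0 : ℂ) 1 ∈ 𝓝 (((1 : ℝ) : ℂ) * z) := by
      simpa using isOpen_ball.mem_nhds hz
    have hcomp : ∀ {f : ℂ → ℂ}, DifferentiableOn ℂ f (ball 0 1) →
        ContinuousAt (fun r : ℝ => f (r * z)) 1 := by
      intro f hf
      exact ContinuousAt.comp (f := fun r : ℝ => (r : ℂ) * z)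
        (hf.continuousOn.continuousAt hz_nhds) (by fun_prop)
    have h3 : ContinuousAt (fun r : ℝ => starRingEnd ℂ ((r : ℂ) * m)) 1 :=
      (Complex.continuous_conj.comp (by fun_prop)).continuousAt
    have key : ∀ P S : ℝ → ℂ, ContinuousAt P 1 → ContinuousAt S 1 →
        ContinuousAt (fun r : ℝ => P r + (a * (z * P r + z + starRingEnd ℂ (r * m)) +
          starRingEnd ℂ a * (r * S r - r * m)) / 2) 1 := by
      intro P S hP hS
      fun_prop
    exact Complex.continuous_re.continuousAt.comp (f := fun r : ℝ => G r z)
      (key _ _ (hcomp hd) (hcomp hs))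
  have hlim : Tendsto (fun r : ℝ => (G r z).re) (𝓝[<] 1) (𝓝 (G 1 z).re) :=
    hcont.tendsto.mono_left nhdsWithin_le_nhds
  have h1 : G 1 z = p z + modulation p a z := by
    simp [G, modulation, hm]
  rw [← h1]
  refine ge_of_tendsto hlim ?_
  filter_upwards [Ioo_mem_nhdsLT (zero_lt_one' ℝ)] with r hr using hG r hr.1 hr.2

lemma ofCaratheodory_mem_U1 {p : ℂ → ℂ} (hp : p ∈ caratheodoryClass) :
    ofCaratheodory p ∈ U1 := by
  obtain ⟨hd, h0, hre⟩ := hp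
  have hon : ∀ z ∈ ball (0 : ℂ) 1, ofCaratheodory p z = -z * p z := fun z hz => by
    rw [ofCaratheodory, if_pos hz]
  refine ⟨?_, ?_, ?_, ?_, ?_⟩
  · refine DifferentiableOn.congr (f := fun z => -z * p z) ?_ hon
    fun_prop
  · simp [ofCaratheodory]
  · have hev : ofCaratheodory p =ᶠ[nhds 0] fun z => -z * p z :=
      Filter.eventuallyEq_of_mem (ball_mem_nhds _ one_pos) hon
    have hp0 := (hd.differentiableAt (ball_mem_nhds _ one_pos)).hasDerivAt
    rw [hev.deriv_eq]
    refine ((hasDerivAt_id (0 : ℂ)).neg.mul hp0).deriv.trans ?_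
    simp [h0]
  · intro z hz
    rw [hon z hz]
    have : (-z * p z * starRingEnd ℂ z).re = -(Complex.normSq z * (p z).re) := by
      simp only [Complex.mul_re, Complex.mul_im, Complex.neg_re, Complex.neg_im, Complex.conj_re,
        Complex.conj_im, Complex.normSq_apply]
      ring
    rw [this]
    linarith [mul_nonneg (Complex.normSq_nonneg z) (hre z hz)]
  · intro z hz
    rw [ofCaratheodory, if_neg hz]

lemma exists_caratheodory_of_mem_U1 {h : ℂ → ℂ} (hh : h ∈ U1) :
    ∃ p ∈ caratheodoryClass, h = ofCaratheodory p := by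
  obtain ⟨hd, h0, h1, hre, hout⟩ := hh
  have hmul : ∀ z, h z = -z * -dslope h 0 z := by
    intro z
    have := sub_smul_dslope h 0 z
    rw [h0, sub_zero, sub_zero, smul_eq_mul] at this
    linear_combination -this
  refine ⟨fun z => -dslope h 0 z, ⟨hd.dslope_ball.neg, by simp [h1], ?_⟩, ?_⟩
  · intro z hz
    rcases eq_or_ne z 0 with rfl | hz0
    · simp [h1]
    · have hz1 := hre z hz
      rw [hmul z] at hz1
      have : (-z * -dslope h 0 z * starRingEnd ℂ z).re =
          -(Complex.normSq z * (-dslope h 0 z).re) := by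
        simp only [Complex.mul_re, Complex.mul_im, Complex.neg_re, Complex.neg_im,
          Complex.conj_re, Complex.conj_im, Complex.normSq_apply]
        ring
      rw [this] at hz1
      exact nonneg_of_mul_nonneg_right (by linarith) (Complex.normSq_pos.2 hz0)
  · funext z
    by_cases hz : z ∈ ball (0 : ℂ) 1
    · rw [ofCaratheodory, if_pos hz]
      exact hmul z
    · rw [ofCaratheodory, if_neg hz, hout z hz]

lemma cayley_mapsTo {p : ℂ → ℂ} (hp : p ∈ caratheodoryClass) :
    DifferentiableOn ℂ (fun z => (p z - 1) / (p z + 1)) (ball 0 1) ∧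
    Set.MapsTo (fun z => (p z - 1) / (p z + 1)) (ball 0 1)
      (closedBall ((p 0 - 1) / (p 0 + 1)) 1) ∧
    deriv (fun z => (p z - 1) / (p z + 1)) 0 = deriv p 0 / 2 ∧
    ∀ z ∈ ball (0 : ℂ) 1, p z + 1 ≠ 0 := by
  obtain ⟨hd, h0, hre⟩ := hp
  have hne : ∀ z ∈ ball (0 : ℂ) 1, p z + 1 ≠ 0 := by
    intro z hz h
    have := congrArg Complex.re h
    simp only [Complex.add_re, Complex.one_re, Complex.zero_re] at this
    linarith [hre z hz]
  refine ⟨(hd.sub_const 1).div (hd.add_const 1) hne, ?_, ?_, hne⟩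
  · intro z hz
    simp only [h0, sub_self, zero_div, mem_closedBall_zero_iff, norm_div]
    refine div_le_one_of_le₀ ?_ (norm_nonneg _)
    refine (sq_le_sq₀ (norm_nonneg _) (norm_nonneg _)).1 ?_
    rw [Complex.sq_norm, Complex.sq_norm, Complex.normSq_apply, Complex.normSq_apply]
    simp only [Complex.sub_re, Complex.add_re, Complex.sub_im, Complex.add_im, Complex.one_re,
      Complex.one_im]
    linarith [hre z hz]
  · have hp0 := (hd.differentiableAt (ball_mem_nhds _ one_pos)).hasDerivAt
    have := (hp0.sub_const 1).div (hp0.add_const 1) (hne 0 (by simp))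
    refine (HasDerivAt.deriv this).trans ?_
    rw [h0]
    ring

lemma norm_deriv_le_two {p : ℂ → ℂ} (hp : p ∈ caratheodoryClass) : ‖deriv p 0‖ ≤ 2 := by
  obtain ⟨h1, h2, h3, -⟩ := cayley_mapsTo hp
  have := Complex.norm_deriv_le_div_of_mapsTo_ball h1 h2 one_pos
  rw [h3, norm_div, Complex.norm_ofNat] at this
  linarith

/-- Equality in the coefficient bound forces a half-plane map. -/
lemma mul_sub_eq_add_of_deriv {p : ℂ → ℂ} (hp : p ∈ caratheodoryClass) {κ : ℂ} (hκ : ‖κ‖ = 1)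
    (h : deriv p 0 = 2 * starRingEnd ℂ κ) {z : ℂ} (hz : z ∈ ball (0 : ℂ) 1) :
    p z * (κ - z) = κ + z := by
  obtain ⟨h1, h2, h3, h4⟩ := cayley_mapsTo hp
  have hz0 : (0 : ℂ) ∈ ball (0 : ℂ) 1 := by simp
  have := Complex.affine_of_mapsTo_ball_of_norm_dslope_eq_div h1 h2 hz0
    (by rw [dslope_same, h3, h]; simp [hκ]) hz
  rw [dslope_same, h3, h, hp.2.1] at this
  simp only [sub_self, zero_div, zero_add, sub_zero, smul_eq_mul] at this
  rw [div_eq_iff (h4 z hz)] at this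
  have hκκ : κ * starRingEnd ℂ κ = 1 := by
    rw [Complex.mul_conj', hκ]; norm_num
  linear_combination κ * this + z * (p z + 1) * hκκ

lemma sub_ne_zero_of_mem_ball {κ z : ℂ} (hκ : ‖κ‖ = 1) (hz : z ∈ ball (0 : ℂ) 1) :
    κ - z ≠ 0 := by
  rintro h
  rw [mem_ball_zero_iff, ← sub_eq_zero.1 h, hκ] at hz
  exact lt_irrefl _ hz

lemma halfPlaneMap_mem {κ : ℂ} (hκ : ‖κ‖ = 1) :
    (fun z => (κ + z) / (κ - z)) ∈ caratheodoryClass := by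
  have hne : ∀ z ∈ ball (0 : ℂ) 1, κ - z ≠ 0 := fun z => sub_ne_zero_of_mem_ball hκ
  refine ⟨?_, ?_, ?_⟩
  · exact DifferentiableOn.div (by fun_prop) (by fun_prop) hne
  · simpa using div_self (by simpa using hne 0 (by simp))
  · intro z hz
    have hz1 : Complex.normSq z ≤ 1 := by
      rw [Complex.normSq_eq_norm_sq]
      have := mem_ball_zero_iff.1 hz
      nlinarith [norm_nonneg z]
    have hκ1 : Complex.normSq κ = 1 := by rw [Complex.normSq_eq_norm_sq, hκ]; norm_num
    rw [Complex.normSq_apply] at hz1 hκ1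
    rw [Complex.div_re, ← add_div]
    refine div_nonneg ?_ (Complex.normSq_nonneg _)
    simp only [Complex.add_re, Complex.sub_re, Complex.add_im, Complex.sub_im]
    nlinarith

lemma ofCaratheodory_halfPlaneMap (κ : ℂ) :
    ofCaratheodory (fun z => (κ + z) / (κ - z)) =
      fun z => if z ∈ ball (0 : ℂ) 1 then -z * (κ + z) / (κ - z) else 0 := by
  funext z
  simp only [ofCaratheodory, mul_div_assoc]

lemma deriv_halfPlaneMap {κ : ℂ} (hκ : ‖κ‖ = 1) :
    deriv (fun z => (κ + z) / (κ - z)) 0 = 2 * starRingEnd ℂ κ := by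
  have hκ0 : κ ≠ 0 := by simpa using sub_ne_zero_of_mem_ball hκ (mem_ball_self one_pos)
  have := ((hasDerivAt_id (0 : ℂ)).const_add κ).div ((hasDerivAt_id (0 : ℂ)).const_sub κ)
    (by simpa using hκ0)
  have hκκ : κ * starRingEnd ℂ κ = 1 := by
    rw [Complex.mul_conj', hκ]; norm_num
  refine (HasDerivAt.deriv this).trans ?_
  simp only [id, sub_zero, add_zero, one_mul]
  rw [div_eq_iff (pow_ne_zero 2 hκ0)]
  linear_combination -2 * κ * hκκ

lemma eq_of_ofCaratheodory_eq {p : ℂ → ℂ} {c : ℂ} {z : ℂ} (hz : z ∈ ball (0 : ℂ) 1)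
    (hz0 : z ≠ 0) (h : ofCaratheodory p z = -z * c) : p z = c := by
  rw [ofCaratheodory, if_pos hz] at h
  exact mul_left_cancel₀ (neg_ne_zero.2 hz0) h

lemma eq_one_of_convex_combination {s t : ℝ} (hs : 0 < s) (ht : 0 < t) (hst : s + t = 1)
    {u v : ℂ} (hu : ‖u‖ ≤ 1) (hv : ‖v‖ ≤ 1) (h : s * u + t * v = 1) : u = 1 := by
  have hre := congrArg Complex.re h
  simp only [Complex.add_re, Complex.re_ofReal_mul, Complex.one_re] at hre
  have hu1 := (Complex.re_le_norm u).trans hu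
  have hv1 := (Complex.re_le_norm v).trans hv
  have hu2 : u.re = 1 := by nlinarith
  have hn : Complex.normSq u ≤ 1 := by
    rw [Complex.normSq_eq_norm_sq]
    nlinarith [norm_nonneg u]
  rw [Complex.normSq_apply, hu2] at hn
  have him : u.im = 0 := by nlinarith [mul_self_nonneg u.im]
  exact Complex.ext hu2 him

lemma halfPlaneMap_mem_extremePoints {κ : ℂ} (hκ : ‖κ‖ = 1) :
    ofCaratheodory (fun z => (κ + z) / (κ - z)) ∈ Set.extremePoints ℝ U1 := by
  rw [mem_extremePoints_iff_left]
  refine ⟨ofCaratheodory_mem_U1 (halfPlaneMap_mem hκ), ?_⟩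
  rintro h₁ hh₁ h₂ hh₂ ⟨s, t, hs, ht, hst, hsum⟩
  obtain ⟨p, hp, rfl⟩ := exists_caratheodory_of_mem_U1 hh₁
  obtain ⟨q, hq, rfl⟩ := exists_caratheodory_of_mem_U1 hh₂
  have hstC : (s : ℂ) + t = 1 := by exact_mod_cast hst
  have hκκ : κ * starRingEnd ℂ κ = 1 := by
    rw [Complex.mul_conj', hκ]; norm_num
  have hcomb : ∀ z ∈ ball (0 : ℂ) 1, (κ + z) / (κ - z) = s * p z + t * q z := by
    intro z hz
    rcases eq_or_ne z 0 with rfl | hz0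
    · refine (halfPlaneMap_mem hκ).2.1.trans ?_
      rw [hp.2.1, hq.2.1]
      linear_combination -hstC
    · refine eq_of_ofCaratheodory_eq (p := fun z => (κ + z) / (κ - z)) hz hz0 ?_
      rw [← hsum]
      simp only [Pi.add_apply, Pi.smul_apply, ofCaratheodory, if_pos hz, Complex.real_smul]
      ring
  have hp0 := (hp.1.differentiableAt (ball_mem_nhds _ one_pos)).hasDerivAt
  have hq0 := (hq.1.differentiableAt (ball_mem_nhds _ one_pos)).hasDerivAt
  have hder : 2 * starRingEnd ℂ κ = s * deriv p 0 + t * deriv q 0 := by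
    rw [← deriv_halfPlaneMap hκ,
      (Filter.eventuallyEq_of_mem (ball_mem_nhds _ one_pos) hcomb).deriv_eq]
    exact ((hp0.const_mul (s : ℂ)).add (hq0.const_mul (t : ℂ))).deriv
  have hbound : ∀ f ∈ caratheodoryClass, ‖κ * deriv f 0 / 2‖ ≤ 1 := by
    intro f hf
    rw [norm_div, norm_mul, hκ, Complex.norm_ofNat]
    linarith [norm_deriv_le_two hf]
  have hu := eq_one_of_convex_combination hs ht hst (hbound p hp) (hbound q hq)
    (by linear_combination (-κ / 2) * hder + hκκ)
  have hpd : deriv p 0 = 2 * starRingEnd ℂ κ := by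
    linear_combination 2 * starRingEnd ℂ κ * hu - deriv p 0 * hκκ
  funext z
  by_cases hz : z ∈ ball (0 : ℂ) 1
  · simp only [ofCaratheodory, if_pos hz]
    rw [eq_div_of_mul_eq (sub_ne_zero_of_mem_ball hκ hz) (mul_sub_eq_add_of_deriv hp hκ hpd hz)]
  · simp only [ofCaratheodory, if_neg hz]

lemma div_add_modulation_mem {p : ℂ → ℂ} (hp : p ∈ caratheodoryClass) {a : ℂ} (ha : ‖a‖ ≤ 1)
    {t : ℝ} (ht : modulation p a 0 = t) (h : 0 < 1 + t) :
    (fun z => (p z + modulation p a z) / ((1 + t : ℝ) : ℂ)) ∈ caratheodoryClass := by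
  refine ⟨(hp.1.add (modulation_differentiableOn hp.1 a)).div_const _, ?_, ?_⟩
  · simp only [ht, hp.2.1]
    push_cast
    exact div_self (by exact_mod_cast h.ne')
  · intro z hz
    rw [Complex.div_ofReal_re]
    exact div_nonneg (re_add_modulation_nonneg hp ha hz) h.le

/-- At an extreme point, every modulation is a multiple of the function itself. -/
lemma modulation_eq_of_mem_extremePoints {p : ℂ → ℂ} (hp : p ∈ caratheodoryClass)
    (hext : ofCaratheodory p ∈ Set.extremePoints ℝ U1) {a : ℂ} (ha : ‖a‖ ≤ 1 / 2)
    {z : ℂ} (hz : z ∈ ball (0 : ℂ) 1) (hz0 : z ≠ 0) :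
    modulation p a z = modulation p a 0 * p z := by
  obtain ⟨t, ht⟩ : ∃ t : ℝ, modulation p a 0 = t := ⟨_, modulation_zero p a⟩
  have ht_neg : modulation p (-a) 0 = (-t : ℝ) := by rw [modulation_neg, ht]; push_cast; rfl
  have habs : |t| < 1 := by
    have h1 : t = (a * starRingEnd ℂ (deriv p 0 / 2)).re := by
      exact_mod_cast ht.symm.trans (modulation_zero p a)
    have h2 : ‖a * starRingEnd ℂ (deriv p 0 / 2)‖ ≤ 1 / 2 := by
      rw [norm_mul, RCLike.norm_conj, norm_div, Complex.norm_ofNat]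
      nlinarith [norm_deriv_le_two hp, norm_nonneg a, norm_nonneg (deriv p 0)]
    rw [h1]
    linarith [Complex.abs_re_le_norm (a * starRingEnd ℂ (deriv p 0 / 2))]
  obtain ⟨hl, hr⟩ := abs_lt.1 habs
  have hne₁ : ((1 + t : ℝ) : ℂ) ≠ 0 := by exact_mod_cast (by linarith : 1 + t ≠ 0)
  have hne₂ : ((1 + -t : ℝ) : ℂ) ≠ 0 := by exact_mod_cast (by linarith : 1 + -t ≠ 0)
  have hm₁ := div_add_modulation_mem hp (ha.trans (by norm_num)) ht (by linarith)
  have hm₂ := div_add_modulation_mem hp (a := -a) (by rw [norm_neg]; linarith) ht_neg (by linarith)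
  have heq := (mem_extremePoints_iff_left.1 hext).2 _ (ofCaratheodory_mem_U1 hm₁) _
    (ofCaratheodory_mem_U1 hm₂) ⟨(1 + t) / 2, (1 + -t) / 2, by linarith, by linarith, by ring, by
      funext w
      by_cases hw : w ∈ ball (0 : ℂ) 1
      · simp only [Pi.add_apply, Pi.smul_apply, ofCaratheodory, if_pos hw, Complex.real_smul,
          modulation_neg]
        push_cast at hne₁ hne₂ ⊢
        field_simp
        ring
      · simp only [Pi.add_apply, Pi.smul_apply, ofCaratheodory, if_neg hw, smul_zero, add_zero]⟩
  have := eq_of_ofCaratheodory_eq hz hz0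
    ((congrFun heq z).trans (by rw [ofCaratheodory, if_pos hz]))
  rw [div_eq_iff hne₁] at this
  rw [ht]
  push_cast at this
  linear_combination this

lemma exists_eq_halfPlaneMap_of_mem_extremePoints {p : ℂ → ℂ} (hp : p ∈ caratheodoryClass)
    (hext : ofCaratheodory p ∈ Set.extremePoints ℝ U1) :
    ∃ κ : ℂ, ‖κ‖ = 1 ∧ ofCaratheodory p = ofCaratheodory fun z => (κ + z) / (κ - z) := by
  set m := deriv p 0 / 2 with hm
  have hA : ∀ z ∈ ball (0 : ℂ) 1, z ≠ 0 →
      z * p z + z + starRingEnd ℂ m = starRingEnd ℂ m * p z ∧ dslope p 0 z - m = m * p z := by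
    intro z hz hz0
    have h1 := modulation_eq_of_mem_extremePoints hp hext (a := 1 / 2) (by norm_num) hz hz0
    have h2 := modulation_eq_of_mem_extremePoints hp hext (a := Complex.I / 2)
      (by simp) hz hz0
    simp only [modulation, dslope_same, ← hm, map_div₀, map_one, map_ofNat, Complex.conj_I] at h1 h2
    rw [show deriv p 0 = 2 * m by rw [hm]; ring] at h1 h2
    have hI := Complex.I_sq
    constructor
    · linear_combination 2 * h1 - 2 * Complex.I * h2 + ((z * p z + z + starRingEnd ℂ m -
        (dslope p 0 z - m) - (starRingEnd ℂ m - m) * p z) / 2) * hI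
    · linear_combination 2 * h1 + 2 * Complex.I * h2 - ((z * p z + z + starRingEnd ℂ m -
        (dslope p 0 z - m) - (starRingEnd ℂ m - m) * p z) / 2) * hI
  have hmul : ∀ z ∈ ball (0 : ℂ) 1, z ≠ 0 →
      p z * (starRingEnd ℂ m - z) = starRingEnd ℂ m + z := by
    intro z hz hz0
    linear_combination -(hA z hz hz0).1
  have hnorm : ‖m‖ = 1 := by
    have hz : (1 / 2 : ℂ) ∈ ball (0 : ℂ) 1 := by
      rw [mem_ball_zero_iff]; norm_num
    have h1 := hmul _ hz (by norm_num)
    have h2 := (hA _ hz (by norm_num)).2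
    have h3 := sub_smul_dslope p 0 (1 / 2)
    rw [hp.2.1, smul_eq_mul] at h3
    have h4 : p (1 / 2) * (1 - m / 2) = 1 + m / 2 := by linear_combination -h3 + h2 / 2
    have h5 : m * starRingEnd ℂ m = 1 := by
      linear_combination (1 - m / 2) * h1 - (starRingEnd ℂ m - 1 / 2) * h4
    rw [Complex.mul_conj'] at h5
    have h6 : ‖m‖ ^ 2 = 1 := by exact_mod_cast h5
    nlinarith [norm_nonneg m]
  have hκ : ‖starRingEnd ℂ m‖ = 1 := by rw [RCLike.norm_conj, hnorm]
  refine ⟨starRingEnd ℂ m, hκ, ?_⟩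
  funext z
  by_cases hz : z ∈ ball (0 : ℂ) 1
  · simp only [ofCaratheodory, if_pos hz]
    rcases eq_or_ne z 0 with rfl | hz0
    · simp
    · rw [eq_div_of_mul_eq (sub_ne_zero_of_mem_ball hκ hz) (hmul z hz hz0)]
  · simp only [ofCaratheodory, if_neg hz]

theorem extreme_points_of_U1 :
    Set.extremePoints ℝ U1 =
      {h | ∃ κ : ℂ, ‖κ‖ = 1 ∧
        h = fun z => if z ∈ ball (0:ℂ) 1 then -z * (κ + z) / (κ - z) else 0} := by
  ext h
  simp only [Set.mem_ofPred_eq, ← ofCaratheodory_halfPlaneMap]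
  constructor
  · intro hext
    obtain ⟨p, hp, rfl⟩ := exists_caratheodory_of_mem_U1 hext.1
    exact exists_eq_halfPlaneMap_of_mem_extremePoints hp hext
  · rintro ⟨κ, hκ, rfl⟩
    exact halfPlaneMap_mem_extremePoints hκ
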